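/- Let G be a labelled graph on d ≥ 2 vertices whose last vertex v = d has the property that its open neighbourhood N(v) (the set of vertices adjacent to v) is a clique in G, i.e., any two distinct neighbours of v are adjacent. Suppose c_{(λ,b)} are rational numbers, indexed by the pairs (λ,b) of an integer partition λ and an integer b ≥ 1 with |λ| + b = d, and π_{(λ,b)} are set partitions of {1,…,d} with type(π_{(λ,b)}) = (λ,b), such that Y_G − Σ_{(λ,b)} c_{(λ,b)} e_{π_{(λ,b)}} ∈ K_d. Then for every integer j ≥ 0, the number of acyclic orientations of the vertex-deleted graph G − v having exactly j sinks, none of which lies in N(v), equals Σ_{λ : ℓ(λ) = j, |λ| = d−1} c_{(λ,1)} · λ!, where ℓ(λ) is the number of parts of λ and λ! = λ_1!⋯λ_{ℓ(λ)}!. -/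

import Mathlib

open scoped Classical
noncomputable section

/-- Words of length `d` in the positive integers. -/
abbrev NCWord (d : ℕ) := Fin d → ℕ+

/-- `M_d`: coefficient functions of homogeneous degree-`d` series in
noncommuting variables. -/
abbrev Md (d : ℕ) := NCWord d → ℚ

/-- `Y_G`, the chromatic symmetric function of a labelled graph in
noncommuting variables, as an element of `M_d`. -/
def YG {d : ℕ} (G : SimpleGraph (Fin d)) : Md d :=
  fun w => if ∀ j k : Fin d, G.Adj j k → w j ≠ w k then 1 else 0

/-- Set partitions of `{0, …, d-1}`. -/
abbrev SetPtn (d : ℕ) := Finpartition (Finset.univ : Finset (Fin d))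

/-- `j` and `k` lie in a common block of `π`. -/
def sameBlock {d : ℕ} (π : SetPtn d) (j k : Fin d) : Prop :=
  ∃ B ∈ π.parts, j ∈ B ∧ k ∈ B

/-- The elementary symmetric function `e_π` in noncommuting variables. -/
def eSP {d : ℕ} (π : SetPtn d) : Md d :=
  fun w => if ∀ j k : Fin d, j ≠ k → sameBlock π j k → w j ≠ w k then 1 else 0

/-- The block of `π` containing `a`. -/
def blockOf {d : ℕ} (π : SetPtn d) (a : Fin d) : Finset (Fin d) :=
  Finset.univ.filter fun k => sameBlock π a k

/-- The type of a set partition relative to the distinguished element `a`: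
the multiset of sizes of the blocks not containing `a` (an integer partition),
together with the size of the block containing `a`. -/
def ptype {d : ℕ} (π : SetPtn d) (a : Fin d) : Multiset ℕ × ℕ :=
  ((π.parts.erase (blockOf π a)).val.map Finset.card, (blockOf π a).card)

/-- `K_d`: the span of the differences `e_{π₁} - e_{π₂}` over pairs of set
partitions of equal type (relative to the distinguished element `a`). -/
def Ksub {d : ℕ} (a : Fin d) : Submodule ℚ (Md d) :=
  Submodule.span ℚ
    {f | ∃ π₁ π₂ : SetPtn d, ptype π₁ a = ptype π₂ a ∧ f = eSP π₁ - eSP π₂}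

/-- `(e)`-positivity of a labelled graph, with distinguished vertex `a`:
`Y_G` is congruent modulo `K_d` to a nonnegative combination of `e_π`'s. -/
def IsEPosNCAt {d : ℕ} (G : SimpleGraph (Fin d)) (a : Fin d) : Prop :=
  ∃ (s : Finset (SetPtn d)) (c : SetPtn d → ℚ),
    (∀ π, 0 ≤ c π) ∧ YG G - ∑ π ∈ s, c π • eSP π ∈ Ksub a

/-- Induction `↑ : M_d → M_{d+1}`. -/
def induct {d : ℕ} (f : Md d) : Md (d + 1) :=
  fun w => if w (Fin.last d) = w ⟨d - 1, by omega⟩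
    then f (fun t => w t.castSucc) else 0

/-- Concatenation of labelled graphs: identify the last vertex of `G` with
the first vertex of `H`. -/
def concatG {p q : ℕ} (G : SimpleGraph (Fin p)) (H : SimpleGraph (Fin q)) :
    SimpleGraph (Fin (p + q - 1)) :=
  SimpleGraph.fromRel fun a b =>
    (∃ i j : Fin p, G.Adj i j ∧ (a : ℕ) = (i : ℕ) ∧ (b : ℕ) = (j : ℕ)) ∨
    (∃ i j : Fin q, H.Adj i j ∧ (a : ℕ) = (i : ℕ) + (p - 1) ∧ (b : ℕ) = (j : ℕ) + (p - 1))

/-- The reverse graph `G^r`. -/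
def revG {d : ℕ} (G : SimpleGraph (Fin d)) : SimpleGraph (Fin d) :=
  SimpleGraph.comap (fun i : Fin d => (⟨d - 1 - (i : ℕ), by have := i.isLt; omega⟩ : Fin d)) G

/-- A labelled graph: a simple graph on vertex set `{0, …, n-1}`, `n ≥ 1`. -/
structure LGraph where
  n : ℕ
  npos : 0 < n
  G : SimpleGraph (Fin n)

/-- The last vertex of a labelled graph. -/
def LGraph.last (A : LGraph) : Fin A.n := ⟨A.n - 1, by have := A.npos; omega⟩

/-- A labelled graph is `(e)`-positive (at its last vertex). -/
def LGraph.EPosNC (A : LGraph) : Prop := IsEPosNCAt A.G A.last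

/-- Concatenation, as an operation on labelled graphs. -/
def LGraph.concat (A B : LGraph) : LGraph :=
  ⟨A.n + B.n - 1, by have := A.npos; have := B.npos; omega, concatG A.G B.G⟩

/-- Reversal, as an operation on labelled graphs. -/
def LGraph.rev (A : LGraph) : LGraph := ⟨A.n, A.npos, revG A.G⟩

/-- Appendable `(e)`-positivity: `G + H` is `(e)`-positive for every
`(e)`-positive labelled graph `G`. -/
def LGraph.Appendable (H : LGraph) : Prop :=
  ∀ A : LGraph, A.EPosNC → (A.concat H).EPosNC

/-- The chromatic symmetric polynomial of `G` in `n` commuting variables. -/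
def cspoly {V : Type} [Fintype V] [DecidableEq V] (G : SimpleGraph V) (n : ℕ) :
    MvPolynomial (Fin n) ℚ :=
  ∑ κ ∈ Finset.univ.filter (fun κ : V → Fin n => ∀ u v : V, G.Adj u v → κ u ≠ κ v),
    ∏ v : V, MvPolynomial.X (κ v)

/-- `e`-positivity of a finite graph. -/
def EPos {V : Type} [Fintype V] [DecidableEq V] (G : SimpleGraph V) : Prop :=
  ∃ c : Nat.Partition (Fintype.card V) → ℚ, (∀ p, 0 ≤ c p) ∧
    ∀ n : ℕ, cspoly G n =
      ∑ p : Nat.Partition (Fintype.card V),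
        c p • (p.parts.map fun r => MvPolynomial.esymm (Fin n) ℚ r).prod

/-- Closed neighbourhood of a vertex, as a finset. -/
def closedNbhd {d : ℕ} (G : SimpleGraph (Fin d)) (i : Fin d) : Finset (Fin d) :=
  Finset.univ.filter fun k => k = i ∨ G.Adj i k

/-- `m_i`: the largest label in the closed neighbourhood of `i`. -/
def mIdx {d : ℕ} (G : SimpleGraph (Fin d)) (i : Fin d) : Fin d :=
  (closedNbhd G i).max' ⟨i, by simp [closedNbhd]⟩

/-- `w_i`: the smallest label in the closed neighbourhood of `i`. -/
def wIdx {d : ℕ} (G : SimpleGraph (Fin d)) (i : Fin d) : Fin d :=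
  (closedNbhd G i).min' ⟨i, by simp [closedNbhd]⟩

/-- Labelled unit interval graph. -/
def IsUnitInterval {d : ℕ} (G : SimpleGraph (Fin d)) : Prop :=
  ∀ i v w j : Fin d, i ≤ v → v < w → w ≤ j → G.Adj i j → G.Adj v w

/-- An acyclic orientation of a graph, as an asymmetric relation with
irreflexive transitive closure whose symmetrization matches adjacency. -/
def IsAcyclicOrientation {V : Type} (G : SimpleGraph V) (r : V → V → Prop) : Prop :=
  (∀ a b, r a b → ¬ r b a) ∧
  (∀ a b, a ≠ b → ((r a b ∨ r b a) ↔ G.Adj a b)) ∧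
  Irreflexive (Relation.TransGen r)

/-- The set of sinks of an orientation. -/
def sinkSet {V : Type} [Fintype V] (r : V → V → Prop) : Finset V :=
  Finset.univ.filter fun x => ∀ y, ¬ r x y

/-- The labelled path `P_d`. -/
def PathG (d : ℕ) : SimpleGraph (Fin d) :=
  SimpleGraph.fromRel fun a b => (b : ℕ) = (a : ℕ) + 1

/-- The labelled cycle `C_d`. -/
def CycleG (d : ℕ) : SimpleGraph (Fin d) :=
  SimpleGraph.fromRel fun a b => (b : ℕ) = (a : ℕ) + 1 ∨ ((a : ℕ) = 0 ∧ (b : ℕ) = d - 1)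

/-! ### Acyclic orientations of induced subgraphs -/

section Orientations

variable {V : Type} [Fintype V]

/-- The spanning subgraph of `H` whose edges are the edges of `H` inside `U`. -/
def within (H : SimpleGraph V) (U : Finset V) : SimpleGraph V where
  Adj a b := H.Adj a b ∧ a ∈ U ∧ b ∈ U
  symm := ⟨fun _ _ h => ⟨h.1.symm, h.2.2, h.2.1⟩⟩
  loopless := ⟨fun _ h => h.1.ne rfl⟩

/-- The sinks of `r` lying in `U`. -/
def sinksIn (r : V → V → Prop) (U : Finset V) : Finset V :=
  U.filter fun x => ∀ y, ¬ r x y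

lemma mem_sinksIn {r : V → V → Prop} {U : Finset V} {x : V} :
    x ∈ sinksIn r U ↔ x ∈ U ∧ ∀ y, ¬ r x y := by simp [sinksIn]

lemma within_univ (H : SimpleGraph V) : within H Finset.univ = H := by
  ext a b; simp [within]

/-- A class of vertices closed under the outgoing arcs of an acyclic relation contains a sink. -/
lemma exists_sink_of_closed {r : V → V → Prop} (hr : ∀ a, ¬ Relation.TransGen r a a)
    (B : Set V) (hB : B.Nonempty) (hcl : ∀ x ∈ B, ∀ y, r x y → y ∈ B) :
    ∃ x ∈ B, ∀ y, ¬ r x y := by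
  let q : V → V → Prop := fun a b => Relation.TransGen r b a
  have : IsTrans V q := ⟨fun a b c h1 h2 => h2.trans h1⟩
  have : Std.Irrefl q := ⟨fun a h => hr a h⟩
  have wf : WellFounded q := Finite.wellFounded_of_trans_of_irrefl q
  obtain ⟨x, hx, hmin⟩ := wf.has_min B hB
  exact ⟨x, hx, fun y hy => hmin y (hcl x hx y hy) (.single hy)⟩

variable [DecidableEq V]

/-- The acyclic orientations of the subgraph of `H` induced on `U`. -/
def acyclicOrientations (H : SimpleGraph V) (U : Finset V) : Finset (V → V → Prop) :=
  Finset.univ.filter (IsAcyclicOrientation (within H U))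

lemma mem_acyclicOrientations {H : SimpleGraph V} {U : Finset V} {r : V → V → Prop} :
    r ∈ acyclicOrientations H U ↔
      (∀ a b, (r a b ∨ r b a) ↔ (H.Adj a b ∧ a ∈ U ∧ b ∈ U)) ∧
        ∀ a, ¬ Relation.TransGen r a a := by
  simp only [acyclicOrientations, Finset.mem_filter, Finset.mem_univ, true_and,
    IsAcyclicOrientation]
  constructor
  · rintro ⟨h1, h2, h3⟩
    refine ⟨fun a b => ?_, fun a h => h3 a h⟩
    by_cases hab : a = b
    · subst hab
      constructor
      · rintro (h | h) <;> exact absurd h (h1 _ _ h)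
      · intro h; exact absurd rfl h.1.ne
    · exact h2 a b hab
  · rintro ⟨h1, h2⟩
    exact ⟨fun a b hab hba => h2 a (.tail (.single hab) hba), fun a b _ => h1 a b, h2⟩

lemma card_acyclicOrientations_empty (H : SimpleGraph V) :
    (acyclicOrientations H ∅).card = 1 := by
  rw [Finset.card_eq_one]
  refine ⟨fun _ _ => False, ?_⟩
  ext r
  rw [mem_acyclicOrientations, Finset.mem_singleton]
  constructor
  · intro h
    funext a b
    have := h.1 a b
    simp only [Finset.notMem_empty, and_false, iff_false, not_or] at this
    exact eq_false this.1
  · rintro rfl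
    refine ⟨by simp, fun a h => ?_⟩
    obtain ⟨z, hz, _⟩ := Relation.TransGen.head'_iff.1 h
    exact hz

lemma sinksIn_nonempty {H : SimpleGraph V} {U : Finset V} {r : V → V → Prop}
    (hr : r ∈ acyclicOrientations H U) (hU : U.Nonempty) : (sinksIn r U).Nonempty := by
  rw [mem_acyclicOrientations] at hr
  obtain ⟨x, hx, h⟩ := exists_sink_of_closed hr.2 (U : Set V) hU
    (fun x _ y hy => ((hr.1 x y).1 (.inl hy)).2.2)
  exact ⟨x, mem_sinksIn.2 ⟨hx, h⟩⟩

lemma not_adj_of_sinks {H : SimpleGraph V} {U : Finset V} {r : V → V → Prop}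
    (hr : r ∈ acyclicOrientations H U) {a b : V} (ha : a ∈ sinksIn r U)
    (hb : b ∈ sinksIn r U) : ¬ H.Adj a b := by
  rw [mem_acyclicOrientations] at hr
  rw [mem_sinksIn] at ha hb
  intro h
  rcases (hr.1 a b).2 ⟨h, ha.1, hb.1⟩ with h | h
  · exact ha.2 _ h
  · exact hb.2 _ h

/-- Acyclic orientations in which all vertices of the independent set `S` are sinks correspond
to acyclic orientations of the graph with `S` removed. -/
lemma card_filter_subset_sinksIn (H : SimpleGraph V) {U S : Finset V} (hS : S ⊆ U) :
    ((acyclicOrientations H U).filter fun r => S ⊆ sinksIn r U).card =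
      if ∀ a ∈ S, ∀ b ∈ S, ¬ H.Adj a b then (acyclicOrientations H (U \ S)).card else 0 := by
  split_ifs with hind
  · refine Finset.card_bij' (fun r _ a b => r a b ∧ b ∉ S)
      (fun r _ a b => r a b ∨ (H.Adj a b ∧ a ∈ U ∧ a ∉ S ∧ b ∈ S)) ?_ ?_ ?_ ?_
    · intro r hr
      rw [Finset.mem_filter, mem_acyclicOrientations] at hr
      obtain ⟨⟨h1, h2⟩, h3⟩ := hr
      rw [mem_acyclicOrientations]
      constructor
      · intro a b
        have hab := h1 a b
        have ha : a ∈ S → ∀ y, ¬ r a y := fun h => (mem_sinksIn.1 (h3 h)).2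
        have hb : b ∈ S → ∀ y, ¬ r b y := fun h => (mem_sinksIn.1 (h3 h)).2
        simp only [Finset.mem_sdiff]
        grind
      · intro a h
        exact h2 a (Relation.TransGen.mono (r := fun a b => r a b ∧ b ∉ S) (fun _ _ h => h.1) a a h)
    · intro r hr
      rw [mem_acyclicOrientations] at hr
      obtain ⟨h1, h2⟩ := hr
      simp only [Finset.mem_sdiff] at h1
      have hout : ∀ a ∈ S, ∀ b, ¬ (r a b ∨ (H.Adj a b ∧ a ∈ U ∧ a ∉ S ∧ b ∈ S)) := by
        rintro a ha b (h | h)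
        · exact ((h1 a b).1 (.inl h)).2.1.2 ha
        · exact h.2.2.1 ha
      rw [Finset.mem_filter, mem_acyclicOrientations]
      refine ⟨⟨?_, ?_⟩, fun x hx => mem_sinksIn.2 ⟨hS hx, hout x hx⟩⟩
      · intro a b
        have hab := h1 a b
        have hsy := H.adj_comm a b
        have ha : a ∈ S → a ∈ U := fun h => hS h
        have hb : b ∈ S → b ∈ U := fun h => hS h
        have hi := hind a
        grind
      · intro x hx
        have key : ∀ y, Relation.TransGen
            (fun a b => r a b ∨ (H.Adj a b ∧ a ∈ U ∧ a ∉ S ∧ b ∈ S)) x y →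
            y ∈ S ∨ Relation.TransGen r x y := by
          intro y h
          induction h with
          | single h =>
            rcases h with h | h
            · exact .inr (.single h)
            · exact .inl h.2.2.2
          | tail _ h ih =>
            rcases ih with ih | ih
            · exact absurd h (hout _ ih _)
            · rcases h with h | h
              · exact .inr (.tail ih h)
              · exact .inl h.2.2.2
        rcases key x hx with h | h
        · obtain ⟨z, hz, _⟩ := Relation.TransGen.head'_iff.1 hx
          exact hout x h z hz
        · exact h2 x h
    · intro r hr
      rw [Finset.mem_filter, mem_acyclicOrientations] at hr
      obtain ⟨⟨h1, h2⟩, h3⟩ := hr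
      funext a b
      have hab := h1 a b
      have ha : a ∈ S → ∀ y, ¬ r a y := fun h => (mem_sinksIn.1 (h3 h)).2
      have hb : b ∈ S → ∀ y, ¬ r b y := fun h => (mem_sinksIn.1 (h3 h)).2
      apply propext
      grind
    · intro r hr
      rw [mem_acyclicOrientations] at hr
      obtain ⟨h1, h2⟩ := hr
      funext a b
      have hab := h1 a b
      simp only [Finset.mem_sdiff] at hab
      apply propext
      grind
  · rw [Finset.card_eq_zero, Finset.filter_eq_empty_iff]
    intro r hr hsub
    exact hind fun a ha b hb => not_adj_of_sinks hr (hsub ha) (hsub hb)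

/-- Double counting of pairs of an acyclic orientation and a set of its sinks. -/
lemma sum_card_mul_eq_sum_sinks {R : Type*} [CommRing R] (H : SimpleGraph V) (U : Finset V)
    (P : Finset V → Prop) [DecidablePred P] (g : Finset V → R) :
    ∑ S ∈ U.powerset.filter P,
        (if ∀ a ∈ S, ∀ b ∈ S, ¬ H.Adj a b then
          ((acyclicOrientations H (U \ S)).card : R) else 0) * g S =
      ∑ r ∈ acyclicOrientations H U, ∑ S ∈ (sinksIn r U).powerset.filter P, g S := by
  have h1 : ∀ S ∈ U.powerset.filter P,
      (if ∀ a ∈ S, ∀ b ∈ S, ¬ H.Adj a b then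
          ((acyclicOrientations H (U \ S)).card : R) else 0) * g S =
        ∑ r ∈ acyclicOrientations H U, if S ⊆ sinksIn r U then g S else 0 := by
    intro S hS
    rw [Finset.mem_filter, Finset.mem_powerset] at hS
    rw [← Finset.sum_filter, Finset.sum_const, card_filter_subset_sinksIn H hS.1, nsmul_eq_mul]
    split_ifs <;> simp
  rw [Finset.sum_congr rfl h1, Finset.sum_comm]
  refine Finset.sum_congr rfl fun r _ => ?_
  rw [← Finset.sum_filter]
  refine Finset.sum_congr ?_ fun _ _ => rfl
  ext S
  simp only [Finset.mem_filter, Finset.mem_powerset]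
  have : S ⊆ sinksIn r U → S ⊆ U := fun h => h.trans (Finset.filter_subset _ _)
  tauto

/-! ### Linear functionals counting acyclic orientations -/

/-- The indicator of proper colourings of `H` that avoid the colour `c` on `N`. -/
def properAvoiding (H : SimpleGraph V) (N : V → Prop) (c : ℕ+) : (V → ℕ+) → ℚ :=
  fun w => if (∀ a b, H.Adj a b → w a ≠ w b) ∧ ∀ a, N a → w a ≠ c then 1 else 0

/-- Given a colouring `w` of the complement of `U` with colours below `k`, there is a linear
functional counting the acyclic orientations of `H` on `U` whenever `w` is admissible. -/
lemma exists_functional_acyclicOrientations (n : ℕ) : ∀ U : Finset V, U.card = n →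
    ∀ (k c : ℕ+) (w : V → ℕ+), c < k → (∀ a ∉ U, w a < k) →
    ∃ L : ((V → ℕ+) → ℚ) →ₗ[ℚ] ℚ, ∀ (H : SimpleGraph V) (N : V → Prop),
      L (properAvoiding H N c) =
        if (∀ a ∉ U, ∀ b ∉ U, H.Adj a b → w a ≠ w b) ∧ (∀ a ∉ U, N a → w a ≠ c) then
          ((acyclicOrientations H U).card : ℚ) else 0 := by
  induction n using Nat.strong_induction_on with
  | _ n ih =>
  intro U hU k c w hck hw
  rcases U.eq_empty_or_nonempty with rfl | hne
  · refine ⟨LinearMap.proj w, fun H N => ?_⟩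
    rw [card_acyclicOrientations_empty]
    simp [properAvoiding]
  · let w' : Finset V → V → ℕ+ := fun S a => if a ∈ S then k else w a
    have hex : ∀ S : Finset V, ∃ L : ((V → ℕ+) → ℚ) →ₗ[ℚ] ℚ, S ⊆ U → S.Nonempty →
        ∀ (H : SimpleGraph V) (N : V → Prop), L (properAvoiding H N c) =
        if (∀ a ∉ U \ S, ∀ b ∉ U \ S, H.Adj a b → w' S a ≠ w' S b) ∧
            (∀ a ∉ U \ S, N a → w' S a ≠ c) then
          ((acyclicOrientations H (U \ S)).card : ℚ) else 0 := by
      intro S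
      by_cases hS : S ⊆ U ∧ S.Nonempty
      · obtain ⟨L, hL⟩ := ih (U \ S).card
          (by rw [← hU]; exact Finset.card_lt_card (Finset.sdiff_ssubset hS.1 hS.2))
          (U \ S) rfl (k + 1) c (w' S) (hck.trans (PNat.lt_add_right k 1)) (by
            intro a ha
            by_cases haS : a ∈ S
            · simp only [w', haS, if_true]; exact PNat.lt_add_right k 1
            · simp only [w', haS, if_false]
              exact (hw a fun h => ha (Finset.mem_sdiff.2 ⟨h, haS⟩)).trans
                (PNat.lt_add_right k 1))
        exact ⟨L, fun _ _ => hL⟩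
      · exact ⟨0, fun h1 h2 => absurd ⟨h1, h2⟩ hS⟩
    choose L hL using hex
    refine ⟨∑ S ∈ U.powerset.filter (fun S => S.Nonempty), (-1 : ℚ) ^ (S.card + 1) • L S,
      fun H N => ?_⟩
    have hval : ∀ S ∈ U.powerset.filter (fun S => S.Nonempty),
        ((-1 : ℚ) ^ (S.card + 1) • L S) (properAvoiding H N c) =
          if (∀ a ∉ U, ∀ b ∉ U, H.Adj a b → w a ≠ w b) ∧ (∀ a ∉ U, N a → w a ≠ c) then
          (if ∀ a ∈ S, ∀ b ∈ S, ¬ H.Adj a b then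
            ((acyclicOrientations H (U \ S)).card : ℚ) else 0) * (-1) ^ (S.card + 1) else 0 := by
      intro S hS
      rw [Finset.mem_filter, Finset.mem_powerset] at hS
      rw [LinearMap.smul_apply, hL S hS.1 hS.2, smul_eq_mul, mul_comm, ite_mul, zero_mul]
      have hcond : ((∀ a ∉ U \ S, ∀ b ∉ U \ S, H.Adj a b → w' S a ≠ w' S b) ∧
            (∀ a ∉ U \ S, N a → w' S a ≠ c)) ↔
          (((∀ a ∉ U, ∀ b ∉ U, H.Adj a b → w a ≠ w b) ∧ (∀ a ∉ U, N a → w a ≠ c)) ∧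
            ∀ a ∈ S, ∀ b ∈ S, ¬ H.Adj a b) := by
        have hSU : ∀ a ∉ U, a ∉ S := fun a ha h => ha (hS.1 h)
        have hwk : ∀ a ∉ U, w a ≠ k := fun a ha => (hw a ha).ne
        have hkc : k ≠ c := hck.ne'
        simp only [Finset.mem_sdiff, not_and, not_not, w']
        constructor
        · rintro ⟨h1, h2⟩
          refine ⟨⟨fun a ha b hb hab => ?_, fun a ha hN => ?_⟩, fun a ha b hb hab => ?_⟩
          · simpa [hSU a ha, hSU b hb] using
              h1 a (fun h => absurd h ha) b (fun h => absurd h hb) hab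
          · simpa [hSU a ha] using h2 a (fun h => absurd h ha) hN
          · simpa [ha, hb] using h1 a (fun _ => ha) b (fun _ => hb) hab
        · rintro ⟨⟨h1, h2⟩, h3⟩
          refine ⟨fun a ha b hb hab => ?_, fun a ha hN => ?_⟩
          · by_cases haS : a ∈ S <;> by_cases hbS : b ∈ S
            · exact absurd hab (h3 a haS b hbS)
            · simpa [haS, hbS] using (hwk b fun h => hbS (hb h)).symm
            · simpa [haS, hbS] using hwk a fun h => haS (ha h)
            · simpa [haS, hbS] using h1 a (fun h => haS (ha h)) b (fun h => hbS (hb h)) hab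
          · by_cases haS : a ∈ S
            · simpa [haS] using hkc
            · simpa [haS] using h2 a (fun h => haS (ha h)) hN
      by_cases h1 : (∀ a ∉ U, ∀ b ∉ U, H.Adj a b → w a ≠ w b) ∧ (∀ a ∉ U, N a → w a ≠ c) <;>
        by_cases h2 : ∀ a ∈ S, ∀ b ∈ S, ¬ H.Adj a b
      · rw [if_pos (hcond.2 ⟨h1, h2⟩), if_pos h1, if_pos h2]
      · rw [if_neg (fun h => h2 (hcond.1 h).2), if_pos h1, if_neg h2, zero_mul]
      · rw [if_neg (fun h => h1 (hcond.1 h).1), if_neg h1]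
      · rw [if_neg (fun h => h1 (hcond.1 h).1), if_neg h1]
    rw [LinearMap.sum_apply, Finset.sum_congr rfl hval]
    split_ifs with hadm
    · rw [sum_card_mul_eq_sum_sinks, Finset.card_eq_sum_ones, Nat.cast_sum]
      refine Finset.sum_congr rfl fun r hr => ?_
      have halt := Finset.sum_powerset_neg_one_pow_card_of_nonempty (sinksIn_nonempty hr hne)
      have hsplit := Finset.sum_filter_add_sum_filter_not (sinksIn r U).powerset
        (fun S => S.Nonempty) (fun S => (-1 : ℤ) ^ S.card)
      have hemp : (sinksIn r U).powerset.filter (fun S => ¬ S.Nonempty) = {∅} := by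
        ext S
        simp only [Finset.mem_filter, Finset.mem_powerset, Finset.not_nonempty_iff_eq_empty,
          Finset.mem_singleton]
        constructor
        · exact fun h => h.2
        · rintro rfl; simp
      rw [hemp, halt, Finset.sum_singleton, Finset.card_empty, pow_zero] at hsplit
      have : ∑ S ∈ (sinksIn r U).powerset.filter (fun S => S.Nonempty),
          (-1 : ℤ) ^ (S.card + 1) = 1 := by
        simp only [pow_succ, ← Finset.sum_mul]
        linarith
      exact_mod_cast this
    · simp

open Polynomial in
/-- A linear functional recording the generating polynomial of acyclic orientations by the number
of sinks, where with the colour `1` only the sinks outside `N` are counted. -/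
lemma exists_functional_sink_polynomial (c : ℕ+) (hc : c < 3) :
    ∃ F : ((V → ℕ+) → ℚ) →ₗ[ℚ] ℚ[X], ∀ (H : SimpleGraph V) (N : V → Prop),
      F (properAvoiding H N c) = ∑ r ∈ acyclicOrientations H Finset.univ,
        (X : ℚ[X]) ^ ((sinksIn r Finset.univ).filter fun x => c = 1 → ¬ N x).card := by
  have hex : ∀ S : Finset V, ∃ L : ((V → ℕ+) → ℚ) →ₗ[ℚ] ℚ,
      ∀ (H : SimpleGraph V) (N : V → Prop), L (properAvoiding H N c) =
        if (∀ a ∉ Finset.univ \ S, ∀ b ∉ Finset.univ \ S, H.Adj a b → (1 : ℕ+) ≠ 1) ∧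
            (∀ a ∉ Finset.univ \ S, N a → 1 ≠ c) then
          ((acyclicOrientations H (Finset.univ \ S)).card : ℚ) else 0 := fun S =>
    exists_functional_acyclicOrientations _ (Finset.univ \ S) rfl 3 c (fun _ => 1) hc
      (fun _ _ => by decide)
  choose L hL using hex
  refine ⟨∑ S ∈ (Finset.univ : Finset V).powerset, (L S).smulRight ((X - 1 : ℚ[X]) ^ S.card),
    fun H N => ?_⟩
  have hval : ∀ S ∈ (Finset.univ : Finset V).powerset,
      ((L S).smulRight ((X - 1 : ℚ[X]) ^ S.card)) (properAvoiding H N c) =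
        if (∀ x ∈ S, c = 1 → ¬ N x) then
          (if ∀ a ∈ S, ∀ b ∈ S, ¬ H.Adj a b then
            ((acyclicOrientations H (Finset.univ \ S)).card : ℚ[X]) else 0) *
              (X - 1) ^ S.card else 0 := by
    intro S _
    rw [LinearMap.smulRight_apply, hL]
    simp only [Finset.mem_sdiff, Finset.mem_univ, true_and, not_not, ne_eq, not_true_eq_false]
    have hcond : (∀ a ∈ S, N a → ¬ 1 = c) ↔ (∀ x ∈ S, c = 1 → ¬ N x) :=
      forall₂_congr fun a _ => by rw [eq_comm]; tauto
    simp only [hcond, imp_false]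
    by_cases h1 : ∀ x ∈ S, c = 1 → ¬ N x <;>
      by_cases h2 : ∀ a ∈ S, ∀ b ∈ S, ¬ H.Adj a b
    · rw [if_pos ⟨h2, h1⟩, if_pos h1, if_pos h2, Polynomial.smul_eq_C_mul]; simp
    · rw [if_neg (fun h => h2 h.1), if_pos h1, if_neg h2]; simp
    · rw [if_neg (fun h => h1 h.2), if_neg h1]; simp
    · rw [if_neg (fun h => h1 h.2), if_neg h1]; simp
  rw [LinearMap.sum_apply, Finset.sum_congr rfl hval, ← Finset.sum_filter,
    sum_card_mul_eq_sum_sinks]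
  refine Finset.sum_congr rfl fun r _ => ?_
  have hpow : (sinksIn r Finset.univ).powerset.filter (fun S => ∀ x ∈ S, c = 1 → ¬ N x) =
      ((sinksIn r Finset.univ).filter fun x => c = 1 → ¬ N x).powerset := by
    ext S
    simp only [Finset.mem_filter, Finset.mem_powerset, Finset.subset_iff]
    exact forall₂_and.symm
  rw [hpow]
  have hX : (X - 1 + 1 : ℚ[X]) = X := by ring
  conv_rhs => rw [← hX]
  rw [← Finset.sum_pow_mul_eq_add_pow]
  simp only [one_pow, mul_one]

/-! ### Disjoint unions of cliques -/

/-- In an acyclic orientation of a disjoint union of cliques, each clique has a sink. -/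
lemma exists_sink_of_cluster {ι : Type*} {H : SimpleGraph V} {q : V → ι}
    (hH : ∀ a b, H.Adj a b ↔ a ≠ b ∧ q a = q b) {U : Finset V} {r : V → V → Prop}
    (hr : r ∈ acyclicOrientations H U) {x : V} (hx : x ∈ U) :
    ∃ y ∈ sinksIn r U, q y = q x := by
  rw [mem_acyclicOrientations] at hr
  obtain ⟨y, hy, hs⟩ := exists_sink_of_closed hr.2 {y | y ∈ U ∧ q y = q x} ⟨x, hx, rfl⟩
    (fun a ha b hab => by
      have := (hr.1 a b).1 (.inl hab)
      exact ⟨this.2.2, ((hH a b).1 this.1).2.symm.trans ha.2⟩)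
  exact ⟨y, mem_sinksIn.2 ⟨hy.1, hs⟩, hy.2⟩

lemma sink_unique_of_cluster {ι : Type*} {H : SimpleGraph V} {q : V → ι}
    (hH : ∀ a b, H.Adj a b ↔ a ≠ b ∧ q a = q b) {U : Finset V} {r : V → V → Prop}
    (hr : r ∈ acyclicOrientations H U) {x y : V} (hx : x ∈ sinksIn r U)
    (hy : y ∈ sinksIn r U) (hxy : q x = q y) : x = y := by
  by_contra h
  exact not_adj_of_sinks hr hx hy ((hH x y).2 ⟨h, hxy⟩)

/-- The number of acyclic orientations of a disjoint union of cliques. -/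
lemma card_acyclicOrientations_cluster {ι : Type*} {H : SimpleGraph V} {q : V → ι}
    (hH : ∀ a b, H.Adj a b ↔ a ≠ b ∧ q a = q b) (I : Finset ι) (n : ℕ) :
    ∀ U : Finset V, U.card = n → (∀ x ∈ U, q x ∈ I) →
      (acyclicOrientations H U).card = ∏ i ∈ I, (U.filter fun x => q x = i).card.factorial := by
  induction n with
  | zero =>
    intro U hU _
    rw [Finset.card_eq_zero] at hU
    subst hU
    simp [card_acyclicOrientations_empty]
  | succ n ih =>
    intro U hU hI
    obtain ⟨x₀, hx₀⟩ : U.Nonempty := Finset.card_pos.1 (by omega)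
    set B := U.filter fun x => q x = q x₀ with hB
    have hone : ∀ r ∈ acyclicOrientations H U, (B.filter fun x => {x} ⊆ sinksIn r U).card = 1 := by
      intro r hr
      obtain ⟨y, hy, hq⟩ := exists_sink_of_cluster hH hr hx₀
      rw [Finset.card_eq_one]
      refine ⟨y, ?_⟩
      ext z
      simp only [Finset.mem_filter, Finset.singleton_subset_iff, Finset.mem_singleton, hB]
      constructor
      · rintro ⟨⟨_, hz⟩, hz'⟩
        exact sink_unique_of_cluster hH hr hz' hy (hz.trans hq.symm)
      · rintro rfl
        exact ⟨⟨(mem_sinksIn.1 hy).1, hq⟩, hy⟩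
    have hdc : (acyclicOrientations H U).card =
        ∑ x ∈ B, ((acyclicOrientations H U).filter fun r => {x} ⊆ sinksIn r U).card := by
      rw [Finset.card_eq_sum_ones, Finset.sum_congr rfl fun r hr => (hone r hr).symm]
      simp only [Finset.card_filter]
      exact Finset.sum_comm
    have hterm : ∀ x ∈ B,
        ((acyclicOrientations H U).filter fun r => {x} ⊆ sinksIn r U).card =
          (B.card - 1).factorial *
            ∏ i ∈ I.erase (q x₀), (U.filter fun x => q x = i).card.factorial := by
      intro x hx
      have hx' := Finset.mem_filter.1 hx
      rw [card_filter_subset_sinksIn H (Finset.singleton_subset_iff.2 hx'.1), if_pos (by simp),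
        ih (U \ {x}) (by rw [Finset.card_sdiff_of_subset (by simpa using hx'.1)]; simp [hU])
          (fun y hy => hI y (Finset.mem_sdiff.1 hy).1),
        ← Finset.mul_prod_erase I _ (hI x₀ hx₀)]
      congr 1
      · rw [← Finset.card_erase_of_mem hx]
        congr 2
        ext y; simp only [hB, Finset.mem_filter, Finset.mem_sdiff, Finset.mem_singleton,
          Finset.mem_erase]; tauto
      · refine Finset.prod_congr rfl fun i hi => ?_
        congr 2
        ext y
        have := (Finset.mem_erase.1 hi).1
        simp only [Finset.mem_filter, Finset.mem_sdiff, Finset.mem_singleton]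
        constructor
        · tauto
        · rintro ⟨h1, h2⟩
          refine ⟨⟨h1, ?_⟩, h2⟩
          rintro rfl
          exact this (h2.symm.trans hx'.2)
    have hBpos : 0 < B.card := Finset.card_pos.2 ⟨x₀, Finset.mem_filter.2 ⟨hx₀, rfl⟩⟩
    rw [hdc, Finset.sum_congr rfl hterm, Finset.sum_const, smul_eq_mul, ← mul_assoc,
      Nat.mul_factorial_pred hBpos.ne', ← Finset.mul_prod_erase I _ (hI x₀ hx₀)]

end Orientations

/-! ### The functional on noncommutative series -/

/-- Acyclic orientations of `G - v`, with `v` the last vertex, without sinks adjacent to `v`. -/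
def goodOrientations {d : ℕ} (G : SimpleGraph (Fin (d + 1))) :
    Finset (Fin d → Fin d → Prop) :=
  (acyclicOrientations (SimpleGraph.comap Fin.castSucc G) Finset.univ).filter fun r =>
    ∀ x ∈ sinkSet r, ¬ G.Adj (Fin.last d) x.castSucc

lemma sinksIn_univ {V : Type} [Fintype V] (r : V → V → Prop) :
    sinksIn r Finset.univ = sinkSet r := by
  ext x; simp [sinksIn, sinkSet]

lemma YG_snoc {d : ℕ} (G : SimpleGraph (Fin (d + 1))) (c : ℕ+) :
    (fun w : Fin d → ℕ+ => YG G (Fin.snoc (α := fun _ => ℕ+) w c)) =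
      properAvoiding (SimpleGraph.comap Fin.castSucc G)
        (fun x => G.Adj (Fin.last d) x.castSucc) c := by
  funext w
  unfold YG properAvoiding
  congr 1
  apply propext
  simp only [Fin.forall_fin_succ', Fin.snoc_castSucc, Fin.snoc_last, SimpleGraph.comap_adj]
  constructor
  · rintro ⟨h1, h2⟩
    exact ⟨fun a b => (h1 a).1 b, fun a ha => (h1 a).2 ha.symm⟩
  · rintro ⟨h1, h2⟩
    exact ⟨fun a => ⟨h1 a, fun h => h2 a h.symm⟩, fun a h => (h2 a h).symm,
      fun h => absurd rfl h.ne⟩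

open Polynomial in
/-- If the neighbourhood of the last vertex is a clique, at most one sink lies in it. -/
lemma X_mul_pow_sub_pow_card_sinkSet {d : ℕ} (G : SimpleGraph (Fin (d + 1)))
    (hclique : ∀ a b : Fin (d + 1),
      G.Adj (Fin.last d) a → G.Adj (Fin.last d) b → a ≠ b → G.Adj a b)
    {r : Fin d → Fin d → Prop}
    (hr : r ∈ acyclicOrientations (SimpleGraph.comap Fin.castSucc G) Finset.univ) :
    (X : ℚ[X]) * X ^ ((sinkSet r).filter fun x => ¬ G.Adj (Fin.last d) x.castSucc).card -
        X ^ (sinkSet r).card =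
      if ∀ x ∈ sinkSet r, ¬ G.Adj (Fin.last d) x.castSucc then
        (X - 1) * X ^ (sinkSet r).card else 0 := by
  split_ifs with h
  · rw [Finset.filter_true_of_mem h]; ring
  · push Not at h
    obtain ⟨x, hx, hadj⟩ := h
    have hfil : (sinkSet r).filter (fun x => ¬ G.Adj (Fin.last d) x.castSucc) =
        (sinkSet r).erase x := by
      ext y
      simp only [Finset.mem_filter, Finset.mem_erase]
      constructor
      · rintro ⟨h1, h2⟩
        exact ⟨fun h => h2 (h ▸ hadj), h1⟩
      · rintro ⟨h1, h2⟩
        refine ⟨h2, fun h => ?_⟩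
        rw [← sinksIn_univ] at hx h2
        exact not_adj_of_sinks hr h2 hx
          (hclique _ _ h hadj fun he => h1 (Fin.castSucc_injective d he))
    rw [hfil, ← pow_succ', Finset.card_erase_add_one hx, sub_self]

open Polynomial in
lemma exists_functional_YG (d : ℕ) :
    ∃ Φ : Md (d + 1) →ₗ[ℚ] ℚ[X], ∀ G : SimpleGraph (Fin (d + 1)),
      (∀ a b : Fin (d + 1),
        G.Adj (Fin.last d) a → G.Adj (Fin.last d) b → a ≠ b → G.Adj a b) →
      Φ (YG G) = (X - 1) * ∑ r ∈ goodOrientations G, X ^ (sinkSet r).card := by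
  obtain ⟨F₁, hF₁⟩ := exists_functional_sink_polynomial (V := Fin d) 1 (by decide)
  obtain ⟨F₂, hF₂⟩ := exists_functional_sink_polynomial (V := Fin d) 2 (by decide)
  let pull (c : ℕ+) : Md (d + 1) →ₗ[ℚ] ((Fin d → ℕ+) → ℚ) :=
    LinearMap.funLeft ℚ ℚ fun w => Fin.snoc (α := fun _ => ℕ+) w c
  have hpull : ∀ c G, pull c (YG G) = properAvoiding (SimpleGraph.comap Fin.castSucc G)
        (fun x => G.Adj (Fin.last d) x.castSucc) c := fun c G => YG_snoc G c
  refine ⟨LinearMap.mulLeft ℚ (X : ℚ[X]) ∘ₗ F₁ ∘ₗ pull 1 - F₂ ∘ₗ pull 2, fun G hG => ?_⟩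
  simp only [LinearMap.sub_apply, LinearMap.comp_apply, hpull, hF₁, hF₂,
    LinearMap.mulLeft_apply, sinksIn_univ]
  have h21 : ¬ (2 : ℕ+) = 1 := by decide
  simp only [h21, false_imp_iff, forall_const, Finset.filter_true]
  rw [Finset.mul_sum, ← Finset.sum_sub_distrib, Finset.mul_sum, goodOrientations,
    Finset.sum_filter]
  exact Finset.sum_congr rfl fun r hr => X_mul_pow_sub_pow_card_sinkSet G hG hr

/-! ### Elementary functions as chromatic functions -/

/-- The disjoint union of the complete graphs on the blocks of `π`. -/
def clusterGraph {d : ℕ} (π : SetPtn d) : SimpleGraph (Fin d) where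
  Adj a b := a ≠ b ∧ blockOf π a = blockOf π b
  symm := ⟨fun _ _ h => ⟨h.1.symm, h.2.symm⟩⟩
  loopless := ⟨fun _ h => h.1 rfl⟩

lemma blockOf_eq_part {d : ℕ} (π : SetPtn d) (a : Fin d) : blockOf π a = π.part a := by
  ext b
  rw [blockOf, Finset.mem_filter, and_iff_right (Finset.mem_univ b)]
  constructor
  · rintro ⟨B, hB, ha, hb⟩
    rwa [π.part_eq_of_mem hB ha]
  · intro h
    exact ⟨π.part a, π.part_mem.2 (Finset.mem_univ a), π.mem_part (Finset.mem_univ a), h⟩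

lemma blockOf_mem_parts {d : ℕ} (π : SetPtn d) (a : Fin d) : blockOf π a ∈ π.parts := by
  rw [blockOf_eq_part]; exact π.part_mem.2 (Finset.mem_univ a)

lemma mem_blockOf_self {d : ℕ} (π : SetPtn d) (a : Fin d) : a ∈ blockOf π a := by
  rw [blockOf_eq_part]; exact π.mem_part (Finset.mem_univ a)

lemma blockOf_eq_iff {d : ℕ} (π : SetPtn d) {a : Fin d} {B : Finset (Fin d)}
    (hB : B ∈ π.parts) : blockOf π a = B ↔ a ∈ B := by
  constructor
  · rintro rfl; exact mem_blockOf_self π a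
  · intro h; rw [blockOf_eq_part]; exact π.part_eq_of_mem hB h

lemma eSP_eq_YG {d : ℕ} (π : SetPtn d) : eSP π = YG (clusterGraph π) := by
  have h : ∀ j k, sameBlock π j k ↔ blockOf π j = blockOf π k := fun j k => by
    rw [eq_comm, blockOf_eq_iff π (blockOf_mem_parts π j)]
    simp [blockOf]
  funext w
  simp [eSP, YG, clusterGraph, h]

lemma goodOrientations_clusterGraph_of_ne_one {d : ℕ} (π : SetPtn (d + 1))
    (hb : (blockOf π (Fin.last d)).card ≠ 1) : goodOrientations (clusterGraph π) = ∅ := by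
  have hpos : 0 < (blockOf π (Fin.last d)).card :=
    Finset.card_pos.2 ⟨_, mem_blockOf_self π (Fin.last d)⟩
  obtain ⟨x, hx, hne⟩ := Finset.exists_mem_ne
    (show 1 < (blockOf π (Fin.last d)).card by omega) (Fin.last d)
  obtain ⟨y, rfl⟩ := Fin.exists_castSucc_eq.2 hne
  have hy := (blockOf_eq_iff π (blockOf_mem_parts π _)).2 hx
  rw [goodOrientations, Finset.filter_eq_empty_iff]
  intro r hr hgood
  obtain ⟨z, hz, hq⟩ := exists_sink_of_cluster (q := fun x : Fin d => blockOf π x.castSucc)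
    (fun a b => by simp [clusterGraph]) hr (Finset.mem_univ y)
  rw [sinksIn_univ] at hz
  exact hgood z hz ⟨(Fin.castSucc_lt_last z).ne', (hq.trans hy).symm⟩

lemma goodOrientations_clusterGraph_of_eq_one {d : ℕ} (π : SetPtn (d + 1))
    (hb : (blockOf π (Fin.last d)).card = 1) :
    (goodOrientations (clusterGraph π)).card =
        ((ptype π (Fin.last d)).1.map Nat.factorial).prod ∧
      ∀ r ∈ goodOrientations (clusterGraph π),
        (sinkSet r).card = (ptype π (Fin.last d)).1.card := by
  set q : Fin d → Finset (Fin (d + 1)) := fun x => blockOf π x.castSucc with hq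
  set I := π.parts.erase (blockOf π (Fin.last d)) with hI
  have hH : ∀ a b, (SimpleGraph.comap Fin.castSucc (clusterGraph π)).Adj a b ↔
      a ≠ b ∧ q a = q b := fun a b => by simp [clusterGraph, hq]
  have hlast : ∀ x : Fin d, q x ≠ blockOf π (Fin.last d) := by
    intro x h
    rw [hq, blockOf_eq_iff π (blockOf_mem_parts π _)] at h
    exact (Fin.castSucc_lt_last x).ne
      (Finset.card_le_one.1 hb.le _ h _ (mem_blockOf_self π _))
  have hqI : ∀ x, q x ∈ I := fun x =>
    Finset.mem_erase.2 ⟨hlast x, blockOf_mem_parts π _⟩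
  have hnotlast : ∀ B ∈ I, Fin.last d ∉ B := fun B hB h =>
    (Finset.mem_erase.1 hB).1 ((blockOf_eq_iff π (Finset.mem_erase.1 hB).2).2 h).symm
  have hmemI : ∀ B ∈ I, ∀ x, q x = B ↔ x.castSucc ∈ B := fun B hB x =>
    blockOf_eq_iff π (Finset.mem_erase.1 hB).2
  have hcard : ∀ B ∈ I, (Finset.univ.filter fun x => q x = B).card = B.card := by
    intro B hB
    rw [← Finset.card_map Fin.castSuccEmb]
    congr 1
    ext x
    simp only [Finset.mem_map, Finset.mem_filter, Finset.mem_univ, true_and, hmemI B hB,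
      Fin.castSuccEmb_apply]
    constructor
    · rintro ⟨y, hy, rfl⟩; exact hy
    · intro hx
      obtain ⟨y, rfl⟩ := Fin.exists_castSucc_eq.2 fun h : x = Fin.last d =>
        hnotlast B hB (h ▸ hx)
      exact ⟨y, hx, rfl⟩
  have hall : goodOrientations (clusterGraph π) =
      acyclicOrientations (SimpleGraph.comap Fin.castSucc (clusterGraph π)) Finset.univ :=
    Finset.filter_true_of_mem fun r _ x _ h => hlast x h.2.symm
  rw [hall]
  refine ⟨?_, fun r hr => ?_⟩
  · rw [card_acyclicOrientations_cluster hH I _ Finset.univ rfl fun x _ => hqI x]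
    refine (Finset.prod_congr rfl fun B hB => ?_).trans
      (b := ∏ B ∈ I, B.card.factorial) ?_
    · rw [← hcard B hB]
      congr!
    · simp [ptype, Multiset.map_map, ← hI]
  · have : (sinkSet r).card = I.card := by
      refine Finset.card_bij (fun x _ => q x) (fun x _ => hqI x) ?_ ?_
      · intro x hx y hy hxy
        rw [← sinksIn_univ] at hx hy
        exact sink_unique_of_cluster hH hr hx hy hxy
      · intro B hB
        obtain ⟨x, hx⟩ := π.nonempty_of_mem_parts (Finset.mem_erase.1 hB).2
        obtain ⟨y, rfl⟩ := Fin.exists_castSucc_eq.2 fun h : x = Fin.last d =>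
          hnotlast B hB (h ▸ hx)
        obtain ⟨z, hz, hzq⟩ := exists_sink_of_cluster hH hr (Finset.mem_univ y)
        rw [sinksIn_univ] at hz
        exact ⟨z, hz, hzq.trans ((hmemI B hB y).2 hx)⟩
    simp [this, ptype, ← hI]

open Polynomial in
lemma sum_goodOrientations_clusterGraph {d : ℕ} (π : SetPtn (d + 1)) :
    ∑ r ∈ goodOrientations (clusterGraph π), (X : ℚ[X]) ^ (sinkSet r).card =
      if (ptype π (Fin.last d)).2 = 1 then
        C (((ptype π (Fin.last d)).1.map Nat.factorial).prod : ℚ) *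
          X ^ (ptype π (Fin.last d)).1.card else 0 := by
  split_ifs with hb
  · obtain ⟨h1, h2⟩ := goodOrientations_clusterGraph_of_eq_one π hb
    rw [Finset.sum_congr rfl fun r hr => by rw [h2 r hr], Finset.sum_const, h1, nsmul_eq_mul]
    simp [Multiset.map_map, map_multiset_prod]
  · rw [goodOrientations_clusterGraph_of_ne_one π hb, Finset.sum_empty]

theorem stmt19 (d : ℕ) (hd : 1 ≤ d) (G : SimpleGraph (Fin (d + 1)))
    (hclique : ∀ a b : Fin (d + 1),
      G.Adj (Fin.last d) a → G.Adj (Fin.last d) b → a ≠ b → G.Adj a b)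
    (s : Finset (SetPtn (d + 1))) (c : SetPtn (d + 1) → ℚ)
    (hdistinct : ∀ π₁ ∈ s, ∀ π₂ ∈ s,
      ptype π₁ (Fin.last d) = ptype π₂ (Fin.last d) → π₁ = π₂)
    (hdecomp : YG G - ∑ π ∈ s, c π • eSP π ∈ Ksub (Fin.last d)) :
    ∀ j : ℕ,
      (Nat.card {r : Fin d → Fin d → Prop //
          IsAcyclicOrientation (SimpleGraph.comap Fin.castSucc G) r ∧
          (sinkSet r).card = j ∧
          ∀ x ∈ sinkSet r, ¬ G.Adj (Fin.last d) x.castSucc} : ℚ) =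
        ∑ π ∈ s.filter (fun π =>
            (ptype π (Fin.last d)).2 = 1 ∧ (ptype π (Fin.last d)).1.card = j),
          c π * (((ptype π (Fin.last d)).1.map Nat.factorial).prod : ℚ) := by
  obtain ⟨Φ, hΦ⟩ := exists_functional_YG d
  have heSP : ∀ π : SetPtn (d + 1), Φ (eSP π) = (Polynomial.X - 1) *
      if (ptype π (Fin.last d)).2 = 1 then
        Polynomial.C (((ptype π (Fin.last d)).1.map Nat.factorial).prod : ℚ) *
          Polynomial.X ^ (ptype π (Fin.last d)).1.card else 0 := by
    intro π
    rw [eSP_eq_YG, hΦ (clusterGraph π) fun a b ha hb hab => ⟨hab, ha.2.symm.trans hb.2⟩,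
      sum_goodOrientations_clusterGraph]
  have hK : Ksub (Fin.last d) ≤ LinearMap.ker Φ := by
    refine Submodule.span_le.2 ?_
    rintro _ ⟨π₁, π₂, h, rfl⟩
    simp only [SetLike.mem_coe, LinearMap.mem_ker, map_sub, heSP, h, sub_self]
  have hker := LinearMap.mem_ker.1 (hK hdecomp)
  rw [map_sub, sub_eq_zero, map_sum, hΦ G hclique] at hker
  simp only [map_smul, heSP, ← mul_smul_comm, ← Finset.mul_sum] at hker
  have hX : (Polynomial.X - 1 : Polynomial ℚ) ≠ 0 := by
    simpa using Polynomial.X_sub_C_ne_zero (1 : ℚ)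
  have hpoly := mul_left_cancel₀ hX hker
  intro j
  have hcoeff := congrArg (fun p => Polynomial.coeff p j) hpoly
  simp only [Polynomial.finsetSum_coeff, Polynomial.coeff_X_pow, Polynomial.coeff_smul] at hcoeff
  have hcount : Nat.card {r : Fin d → Fin d → Prop //
      IsAcyclicOrientation (SimpleGraph.comap Fin.castSucc G) r ∧
      (sinkSet r).card = j ∧ ∀ x ∈ sinkSet r, ¬ G.Adj (Fin.last d) x.castSucc} =
      ((goodOrientations G).filter fun r => j = (sinkSet r).card).card := by
    rw [Nat.card_eq_fintype_card, Fintype.card_subtype]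
    congr 1
    ext r
    simp only [goodOrientations, acyclicOrientations, within_univ, Finset.mem_filter,
      Finset.mem_univ, true_and, eq_comm (a := j)]
    tauto
  rw [hcount, Finset.card_filter, Nat.cast_sum]
  push_cast
  rw [hcoeff, Finset.sum_filter]
  refine Finset.sum_congr rfl fun π _ => ?_
  by_cases h1 : (ptype π (Fin.last d)).2 = 1
  · simp [h1, Polynomial.coeff_X_pow, eq_comm (a := j)]
  · simp [h1]
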